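/- arXiv:1407.4548 — 2 statements merged into one kernel-verified Lean document; each statement's English description precedes it below -/
import Mathlib

section
/- Let a, b, z, w be unit quaternions, and let Σ = {(y, a y b⁻¹) : y a unit quaternion} be a great 3-sphere in S³ × S³. Then the distance in the Riemannian product metric from the point (z, w) to Σ satisfies: the infimum over unit quaternions y of √(dS(z, y)² + dS(w, a y b⁻¹)²) equals (1/√2) · dS(z, a⁻¹ w b). -/
open Quaternion

/-- Geodesic distance on the unit 3-sphere of quaternions: `dS(a,b) = arccos ⟪a, b⟫` where
`⟪a, b⟫ = re(a * star b)`. -/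
noncomputable def dS (a b : ℍ[ℝ]) : ℝ := Real.arccos (a * star b).re

theorem aux_dS_inner (a b : ℍ[ℝ]) : dS a b = Real.arccos (inner ℝ a b) := rfl

theorem aux_dS_angle (a b : ℍ[ℝ]) (ha : ‖a‖ = 1) (hb : ‖b‖ = 1) :
    dS a b = InnerProductGeometry.angle a b := by
  rw [aux_dS_inner, InnerProductGeometry.angle, ha, hb]; simp

theorem aux_inv (a : ℍ[ℝ]) (ha : ‖a‖ = 1) : a⁻¹ = star a := by
  rw [Quaternion.instInv]
  simp [Quaternion.normSq_eq_norm_mul_self, ha]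

theorem aux_re_comm (p q : ℍ[ℝ]) : (p * q).re = (q * p).re := by
  simp only [Quaternion.re_mul]; ring

theorem aux_dS_move (a b w y : ℍ[ℝ]) (ha : ‖a‖ = 1) (hb : ‖b‖ = 1) :
    dS w (a * y * b⁻¹) = dS y (a⁻¹ * w * b) := by
  rw [aux_dS_inner y, real_inner_comm, ← aux_dS_inner]
  rw [aux_inv a ha, aux_inv b hb]
  unfold dS
  rw [star_mul, star_mul, star_star, ← mul_assoc, ← mul_assoc, aux_re_comm]
  simp only [mul_assoc]

theorem aux_ortho (z u : ℍ[ℝ]) (hz : ‖z‖ = 1) (hu : ‖u‖ = 1) (t : ℝ)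
    (ht : Real.cos t = inner ℝ z u) :
    ∃ e : ℍ[ℝ], ‖e‖ = 1 ∧ inner ℝ z e = 0 ∧ u = Real.cos t • z + Real.sin t • e := by
  have hzz : inner ℝ z z = (1 : ℝ) := by rw [real_inner_self_eq_norm_sq, hz]; norm_num
  have huu : inner ℝ u u = (1 : ℝ) := by rw [real_inner_self_eq_norm_sq, hu]; norm_num
  have hn : ‖u - Real.cos t • z‖ ^ 2 = Real.sin t ^ 2 := by
    rw [← real_inner_self_eq_norm_sq]
    have huz : inner ℝ u z = Real.cos t := by rw [ht, real_inner_comm]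
    have := Real.sin_sq_add_cos_sq t
    simp only [inner_sub_left, inner_sub_right, real_inner_smul_left, real_inner_smul_right,
      hzz, huu, huz, ← ht]
    nlinarith
  by_cases hs : Real.sin t = 0
  · obtain ⟨e, he1, he2, he3, he4⟩ : ∃ e : ℍ[ℝ], e.re = -z.imI ∧ e.imI = z.re ∧
        e.imJ = -z.imK ∧ e.imK = z.imJ :=
      ⟨⟨-z.imI, z.re, -z.imK, z.imJ⟩, rfl, rfl, rfl, rfl⟩
    refine ⟨e, ?_, ?_, ?_⟩
    · have h1 : Quaternion.normSq e = Quaternion.normSq z := by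
        rw [Quaternion.normSq_def', Quaternion.normSq_def', he1, he2, he3, he4]; ring
      rw [Quaternion.normSq_eq_norm_mul_self, Quaternion.normSq_eq_norm_mul_self, hz] at h1
      nlinarith [norm_nonneg e]
    · rw [Quaternion.inner_def, Quaternion.re_mul]
      simp only [Quaternion.re_star, Quaternion.imI_star, Quaternion.imJ_star,
        Quaternion.imK_star, he1, he2, he3, he4]
      ring
    · rw [hs] at hn ⊢
      have : ‖u - Real.cos t • z‖ = 0 := by simpa using hn
      rw [norm_eq_zero, sub_eq_zero] at this
      simpa using this
  · refine ⟨(Real.sin t)⁻¹ • (u - Real.cos t • z), ?_, ?_, ?_⟩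
    · rw [norm_smul, ← sq_eq_sq₀ (by positivity) (by norm_num), mul_pow, hn]
      simp [hs]
    · simp only [real_inner_smul_right, inner_sub_right, hzz, ← ht]; ring
    · rw [smul_smul, mul_inv_cancel₀ hs]; simp

theorem aux_mid (z u : ℍ[ℝ]) (hz : ‖z‖ = 1) (hu : ‖u‖ = 1) :
    ∃ y : ℍ[ℝ], ‖y‖ = 1 ∧ dS z y = dS z u / 2 ∧ dS y u = dS z u / 2 := by
  set t := dS z u with ht
  have h0 : 0 ≤ t := Real.arccos_nonneg _
  have h1 : t ≤ Real.pi := Real.arccos_le_pi _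
  have hc : Real.cos t = inner ℝ z u := by
    rw [ht, aux_dS_angle z u hz hu, InnerProductGeometry.cos_angle, hz, hu]; simp
  obtain ⟨e, he, hze, hue⟩ := aux_ortho z u hz hu t hc
  have hzz : inner ℝ z z = (1 : ℝ) := by rw [real_inner_self_eq_norm_sq, hz]; norm_num
  have hee : inner ℝ e e = (1 : ℝ) := by rw [real_inner_self_eq_norm_sq, he]; norm_num
  have hez : inner ℝ e z = (0 : ℝ) := by rw [real_inner_comm, hze]
  refine ⟨Real.cos (t/2) • z + Real.sin (t/2) • e, ?_, ?_, ?_⟩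
  · rw [← sq_eq_sq₀ (by positivity) (by norm_num), ← real_inner_self_eq_norm_sq]
    have := Real.sin_sq_add_cos_sq (t/2)
    simp only [inner_add_left, inner_add_right, real_inner_smul_left, real_inner_smul_right,
      hzz, hee, hez, hze]
    nlinarith
  · rw [aux_dS_inner]
    simp only [inner_add_left, inner_add_right, real_inner_smul_left, real_inner_smul_right,
      hzz, hee, hez, hze, mul_one, mul_zero, add_zero]
    exact Real.arccos_cos (by linarith) (by linarith)
  · rw [aux_dS_inner, hue]
    simp only [inner_add_left, inner_add_right, real_inner_smul_left, real_inner_smul_right,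
      hzz, hee, hez, hze, mul_one, mul_zero, add_zero, zero_add]
    have : Real.cos t * Real.cos (t/2) + Real.sin t * Real.sin (t/2) = Real.cos (t/2) := by
      rw [← Real.cos_sub]; congr 1; ring
    rw [show Real.cos t * Real.cos (t/2) + Real.sin t * Real.sin (t/2) = Real.cos (t/2) from this]
    exact Real.arccos_cos (by linarith) (by linarith)

/-- For unit quaternions `a, b, z, w`, the distance in the Riemannian product
metric from `(z, w)` to the great 3-sphere `Σ = {(y, a y b⁻¹)}` equals
`(1/√2)·dS(z, a⁻¹ w b)`. -/
theorem dist_point_to_great_sphere (a b z w : ℍ[ℝ])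
    (ha : ‖a‖ = 1) (hb : ‖b‖ = 1) (hz : ‖z‖ = 1) (hw : ‖w‖ = 1) :
    sInf {v : ℝ | ∃ y : ℍ[ℝ], ‖y‖ = 1 ∧
        v = Real.sqrt (dS z y ^ 2 + dS w (a * y * b⁻¹) ^ 2)} =
      (1 / Real.sqrt 2) * dS z (a⁻¹ * w * b) := by
  have hu : ‖a⁻¹ * w * b‖ = 1 := by simp [ha, hb, hw]
  set u := a⁻¹ * w * b with hu'
  have key : ∀ s : ℝ, 0 ≤ s → 1 / Real.sqrt 2 * s = Real.sqrt (s ^ 2 / 2) := by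
    intro s hs
    rw [Real.sqrt_div (by positivity), Real.sqrt_sq hs]; ring
  have h0 : 0 ≤ dS z u := Real.arccos_nonneg _
  rw [key _ h0]
  apply IsLeast.csInf_eq
  constructor
  · obtain ⟨y, hy, h1, h2⟩ := aux_mid z u hz hu
    refine ⟨y, hy, ?_⟩
    rw [aux_dS_move a b w y ha hb, ← hu', h1, h2]
    congr 1; ring
  · rintro v ⟨y, hy, rfl⟩
    rw [aux_dS_move a b w y ha hb, ← hu']
    apply Real.sqrt_le_sqrt
    have h3 : dS z u ≤ dS z y + dS y u := by
      rw [aux_dS_angle z u hz hu, aux_dS_angle z y hz hy, aux_dS_angle y u hy hu]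
      exact InnerProductGeometry.angle_le_angle_add_angle z y u
    nlinarith [sq_nonneg (dS z y - dS y u)]
end

section
/- For all unit quaternions p, q, c and every unit quaternion z, the distance from the point (z, p z c⁻¹) of the Hopf fiber {(x, p x c⁻¹)} to the Hopf fiber {(y, q y c⁻¹)} equals (1/√2) · Real.arccos(re(q⁻¹ * p)); that is, the infimum over unit quaternions y of √(dS(z, y)² + dS(p z c⁻¹, q y c⁻¹)²) equals (1/√2) · Real.arccos(re(q⁻¹ * p)), which is independent of z. Hence any two fibers of a Hopf fibration of S³ × S³ (fibers {(x, p x c⁻¹)} with c fixed and p varying) are parallel. -/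
open Quaternion

lemma hf_dot (a b : ℍ[ℝ]) : (a * star b).re =
    a.re * b.re + a.imI * b.imI + a.imJ * b.imJ + a.imK * b.imK := by
  simp

lemma hf_sq {a : ℍ[ℝ]} (h : ‖a‖ = 1) : a.re^2 + a.imI^2 + a.imJ^2 + a.imK^2 = 1 := by
  rw [← Quaternion.normSq_def', Quaternion.normSq_eq_norm_mul_self, h]; norm_num

lemma hf_norm {a : ℍ[ℝ]} (h : a.re^2 + a.imI^2 + a.imJ^2 + a.imK^2 = 1) : ‖a‖ = 1 := by
  rw [← Quaternion.normSq_def', Quaternion.normSq_eq_norm_mul_self] at h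
  nlinarith [norm_nonneg a]

lemma hf_star {a : ℍ[ℝ]} (h : ‖a‖ = 1) : star a * a = 1 := by
  rw [Quaternion.star_mul_self, Quaternion.normSq_eq_norm_mul_self, h]; norm_num

lemma hf_star' {a : ℍ[ℝ]} (h : ‖a‖ = 1) : a * star a = 1 := by
  rw [Quaternion.self_mul_star, Quaternion.normSq_eq_norm_mul_self, h]; norm_num

lemma hf_inv {a : ℍ[ℝ]} (h : ‖a‖ = 1) : a⁻¹ = star a :=
  inv_eq_of_mul_eq_one_right (hf_star' h)

lemma hf_comm (a b : ℍ[ℝ]) : (a * b).re = (b * a).re := by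
  simp only [Quaternion.re_mul]; ring

lemma hf_angle {a b : ℍ[ℝ]} (ha : ‖a‖ = 1) (hb : ‖b‖ = 1) :
    dS a b = InnerProductGeometry.angle a b := by
  simp [dS, InnerProductGeometry.angle, ha, hb, Quaternion.inner_def]

lemma hf_mid (g : ℍ[ℝ]) (hg : ‖g‖ = 1) : ∃ h : ℍ[ℝ], ‖h‖ = 1 ∧
    h.re = Real.cos (Real.arccos g.re / 2) ∧
    (g * star h).re = Real.cos (Real.arccos g.re / 2) := by
  have hs := hf_sq hg
  have h1 : -1 ≤ g.re := by
    nlinarith [sq_nonneg g.imI, sq_nonneg g.imJ, sq_nonneg g.imK]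
  have h2 : g.re ≤ 1 := by
    nlinarith [sq_nonneg g.imI, sq_nonneg g.imJ, sq_nonneg g.imK]
  have hcos : Real.cos (Real.arccos g.re / 2) = √((1 + g.re) / 2) := by
    rw [Real.cos_half (by linarith [Real.arccos_nonneg g.re, Real.pi_pos])
      (Real.arccos_le_pi _), Real.cos_arccos h1 h2]
  rw [hcos]
  rcases h1.eq_or_lt with h | h
  · refine ⟨⟨0, 1, 0, 0⟩, hf_norm (by simp), ?_, ?_⟩
    · simp [← h]
    · have : g.imI = 0 := by
        rw [← h] at hs
        nlinarith [sq_nonneg g.imI, sq_nonneg g.imJ, sq_nonneg g.imK]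
      refine (hf_dot _ _).trans ?_; simp [← h, this]
  · set k := √((1 + g.re) / 2) with hk
    have hk0 : 0 < k := Real.sqrt_pos.2 (by linarith)
    have hk2 : k ^ 2 = (1 + g.re) / 2 := Real.sq_sqrt (by linarith)
    refine ⟨⟨(1 + g.re) / (2*k), g.imI / (2*k), g.imJ / (2*k), g.imK / (2*k)⟩,
      hf_norm ?_, ?_, ?_⟩
    · simp only []
      field_simp
      nlinarith
    · simp only []
      field_simp
      nlinarith
    · refine (hf_dot _ _).trans ?_
      simp only []
      field_simp
      nlinarith

/-- The distance from any point `(z, p z c⁻¹)` of the Hopf fiber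
`{(x, p x c⁻¹)}` to the Hopf fiber `{(y, q y c⁻¹)}` equals `(1/√2)·arccos(re(q⁻¹ p))`,
independently of `z`: any two fibers of a Hopf fibration of `S³ × S³` are parallel. -/
theorem hopf_fibers_parallel (p q c z : ℍ[ℝ])
    (hp : ‖p‖ = 1) (hq : ‖q‖ = 1) (hc : ‖c‖ = 1) (hz : ‖z‖ = 1) :
    sInf {v : ℝ | ∃ y : ℍ[ℝ], ‖y‖ = 1 ∧
        v = Real.sqrt (dS z y ^ 2 + dS (p * z * c⁻¹) (q * y * c⁻¹) ^ 2)} =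
      (1 / Real.sqrt 2) * Real.arccos (q⁻¹ * p).re := by
  have hg : ‖q⁻¹ * p‖ = 1 := by rw [norm_mul, norm_inv, hp, hq]; norm_num
  have hd : ∀ y, dS (p * z * c⁻¹) (q * y * c⁻¹) = dS (q⁻¹ * p * z) y := by
    intro y
    unfold dS
    rw [hf_inv hc, hf_inv hq]
    congr 1
    have : p * z * star c * star (q * y * star c) = (p * z * star y) * star q := by
      simp only [star_mul, star_star]
      calc _ = p * z * (star c * c) * (star y * star q) := by simp only [mul_assoc]
        _ = _ := by rw [hf_star hc]; simp only [mul_assoc, mul_one]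
    rw [this, hf_comm]
    simp only [mul_assoc]
  simp only [hd]
  set g := q⁻¹ * p with hgdef
  have hgz : ‖g * z‖ = 1 := by rw [norm_mul, hg, hz, one_mul]
  have hθ : dS (g * z) z = Real.arccos g.re := by
    unfold dS
    rw [mul_assoc, hf_star' hz, mul_one]
  have hval : (1 / √2) * Real.arccos g.re = √(Real.arccos g.re ^ 2 / 2) := by
    rw [Real.sqrt_div (sq_nonneg _), Real.sqrt_sq (Real.arccos_nonneg _)]; ring
  rw [hval]
  refine IsLeast.csInf_eq ⟨?_, ?_⟩
  · obtain ⟨h, hh, e1, e2⟩ := hf_mid g hg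
    have ha : Real.arccos (Real.cos (Real.arccos g.re / 2)) = Real.arccos g.re / 2 :=
      Real.arccos_cos (by linarith [Real.arccos_nonneg g.re])
        (by linarith [Real.arccos_le_pi g.re, Real.arccos_nonneg g.re])
    refine ⟨h * z, by rw [norm_mul, hh, hz, one_mul], ?_⟩
    have d1 : dS z (h * z) = Real.arccos g.re / 2 := by
      unfold dS
      rw [star_mul, ← mul_assoc, hf_star' hz, one_mul, Quaternion.re_star, e1, ha]
    have d2 : dS (g * z) (h * z) = Real.arccos g.re / 2 := by
      unfold dS
      have : g * z * star (h * z) = g * star h := by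
        rw [star_mul]
        calc _ = g * (z * star z) * star h := by simp only [mul_assoc]
          _ = _ := by rw [hf_star' hz, mul_one]
      rw [this, e2, ha]
    rw [d1, d2]
    congr 1; ring
  · rintro v ⟨y, hy, rfl⟩
    apply Real.sqrt_le_sqrt
    have ht := InnerProductGeometry.angle_le_angle_add_angle (g * z) y z
    rw [← hf_angle hgz hz, ← hf_angle hgz hy, InnerProductGeometry.angle_comm y z,
      ← hf_angle hz hy, hθ] at ht
    nlinarith [Real.arccos_nonneg g.re, sq_nonneg (dS z y - dS (g * z) y)]
end
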